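/- Let a, d be positive integers with d² − 2d + 2 − a = 0, and set q = ad. Then any 3-MIPPC(2,M,q) satisfies M ≤ ad². Equivalently: the real polynomial f(M) = M³ − 2qM² + 2q²M − q⁴ satisfies f(ad²) = 0, f is strictly increasing in M, and hence ad² is the largest integer M with M³ − 2qM² + 2q²M − q⁴ ≤ 0. -/

import Mathlib

/-- The descendant code of a sub-code of a code of length 2, viewed as a set of pairs. -/
def desc2 {q : ℕ} (C' : Finset (Fin q × Fin q)) : Set (Fin q × Fin q) :=
  {x | (∃ c ∈ C', c.1 = x.1) ∧ (∃ c ∈ C', c.2 = x.2)}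

/-- `C` is a `t`-MIPPC of length 2: for every descendant set produced by some nonempty
sub-code of size at most `t`, all such parent sets have a common codeword. -/
def isMIPPC2 {q : ℕ} (t : ℕ) (C : Finset (Fin q × Fin q)) : Prop :=
  ∀ S : Set (Fin q × Fin q),
    (∃ C' : Finset (Fin q × Fin q), C' ⊆ C ∧ C'.Nonempty ∧ C'.card ≤ t ∧ desc2 C' = S) →
    ∃ c, ∀ C' : Finset (Fin q × Fin q),
      C' ⊆ C → C'.Nonempty → C'.card ≤ t → desc2 C' = S → c ∈ C'

/-- `A¹_a = {b : (a,b) ∈ C}`. -/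
def A1 {q : ℕ} (C : Finset (Fin q × Fin q)) (a : Fin q) : Finset (Fin q) :=
  (C.filter (fun c => c.1 = a)).image Prod.snd

/-- Condition (I). -/
def CondI {q : ℕ} (C : Finset (Fin q × Fin q)) : Prop :=
  ∀ a₁ a₂ : Fin q, a₁ ≠ a₂ → (A1 C a₁ ∩ A1 C a₂).card ≤ 1

/-- Condition (II). -/
def CondII {q : ℕ} (C : Finset (Fin q × Fin q)) : Prop :=
  ¬ ∃ a₁ a₂ a₃ b₁ b₂ b₃ : Fin q,
      a₁ ≠ a₂ ∧ a₁ ≠ a₃ ∧ a₂ ≠ a₃ ∧ b₁ ≠ b₂ ∧ b₁ ≠ b₃ ∧ b₂ ≠ b₃ ∧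
      b₁ ∈ A1 C a₁ ∧ b₂ ∈ A1 C a₁ ∧ b₂ ∈ A1 C a₂ ∧ b₃ ∈ A1 C a₂ ∧
      b₁ ∈ A1 C a₃ ∧ b₃ ∈ A1 C a₃

/-- In a `t`-MIPPC, two sub-codes of size at most `t` with the same coordinate projections are
not disjoint. -/
theorem isMIPPC2.not_disjoint {q t : ℕ} {C D E : Finset (Fin q × Fin q)} (hC : isMIPPC2 t C)
    (hD : D ⊆ C) (hE : E ⊆ C) (hD₀ : D.Nonempty) (hE₀ : E.Nonempty)
    (hDt : D.card ≤ t) (hEt : E.card ≤ t) (h : desc2 D = desc2 E) : ¬ Disjoint D E := by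
  obtain ⟨c, hc⟩ := hC (desc2 E) ⟨E, hE, hE₀, hEt, rfl⟩
  exact Finset.not_disjoint_iff.2 ⟨c, hc D hD hD₀ hDt h, hc E hE hE₀ hEt rfl⟩

/-- The bipartite graph of a 3-MIPPC of length 2 has no 4-cycle. -/
theorem isMIPPC2.no_four_cycle {q : ℕ} {C : Finset (Fin q × Fin q)} (hC : isMIPPC2 3 C)
    {x u y v : Fin q} (hxu : x ≠ u) (hyv : y ≠ v) (h₁ : (x, y) ∈ C) (h₂ : (x, v) ∈ C)
    (h₃ : (u, y) ∈ C) : (u, v) ∉ C := by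
  intro h₄
  refine hC.not_disjoint (D := {(x, y), (u, v)}) (E := {(x, v), (u, y)}) ?_ ?_ (by simp) (by simp)
    (Finset.card_le_two.trans (by norm_num)) (Finset.card_le_two.trans (by norm_num)) ?_ ?_
  · simp [Finset.insert_subset_iff, *]
  · simp [Finset.insert_subset_iff, *]
  · ext ⟨i, j⟩
    simp [desc2]
    tauto
  · simp [hxu, hyv, hxu.symm, hyv.symm]

/-- The bipartite graph of a 3-MIPPC of length 2 has no 6-cycle. -/
theorem isMIPPC2.no_six_cycle {q : ℕ} {C : Finset (Fin q × Fin q)} (hC : isMIPPC2 3 C)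
    {x u w y v z : Fin q} (hxu : x ≠ u) (hxw : x ≠ w) (huw : u ≠ w)
    (hyv : y ≠ v) (hyz : y ≠ z) (hvz : v ≠ z)
    (h₁ : (x, y) ∈ C) (h₂ : (x, z) ∈ C) (h₃ : (w, y) ∈ C)
    (h₄ : (u, v) ∈ C) (h₅ : (u, z) ∈ C) : (w, v) ∉ C := by
  intro h₆
  refine hC.not_disjoint (D := {(x, y), (w, v), (u, z)}) (E := {(x, z), (w, y), (u, v)})
    ?_ ?_ (by simp) (by simp) Finset.card_le_three Finset.card_le_three ?_ ?_
  · simp [Finset.insert_subset_iff, *]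
  · simp [Finset.insert_subset_iff, *]
  · ext ⟨i, j⟩
    simp [desc2]
    tauto
  · simp [hxu, hyv, hxu.symm, hyv.symm, hxw, hxw.symm, huw, huw.symm, hyz, hyz.symm, hvz,
      hvz.symm]

/-- The neighbours in the second coordinate of `x`. -/
def rowNbrs {q : ℕ} (C : Finset (Fin q × Fin q)) (x : Fin q) : Finset (Fin q) :=
  Finset.univ.filter fun y => (x, y) ∈ C

/-- The neighbours in the first coordinate of `y`. -/
def colNbrs {q : ℕ} (C : Finset (Fin q × Fin q)) (y : Fin q) : Finset (Fin q) :=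
  Finset.univ.filter fun x => (x, y) ∈ C

/-- Each pair is joined by at most one path of length 1 or 3 in the bipartite graph of a
3-MIPPC. -/
theorem isMIPPC2.card_add_sum_le {q : ℕ} {C : Finset (Fin q × Fin q)} (hC : isMIPPC2 3 C) :
    C.card + ∑ c ∈ C, ((rowNbrs C c.1).card - 1) * ((colNbrs C c.2).card - 1) ≤ q ^ 2 := by
  classical
  set T : Finset (Σ _ : Fin q × Fin q, Fin q × Fin q) :=
    C.sigma fun c => (colNbrs C c.2).erase c.1 ×ˢ (rowNbrs C c.1).erase c.2 with hT
  have mem_T : ∀ x y u v : Fin q, (⟨(x, y), (u, v)⟩ : Σ _ : Fin q × Fin q, Fin q × Fin q) ∈ T ↔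
      (x, y) ∈ C ∧ (u ≠ x ∧ (u, y) ∈ C) ∧ v ≠ y ∧ (x, v) ∈ C := by
    intro x y u v
    simp [hT, rowNbrs, colNbrs]
  have card_T : T.card =
      ∑ c ∈ C, ((rowNbrs C c.1).card - 1) * ((colNbrs C c.2).card - 1) := by
    rw [hT, Finset.card_sigma]
    refine Finset.sum_congr rfl fun c hc => ?_
    rw [Finset.card_product, Finset.card_erase_of_mem (by simpa [colNbrs] using hc),
      Finset.card_erase_of_mem (by simpa [rowNbrs] using hc), mul_comm]
  have inj : Set.InjOn (fun p : Σ _ : Fin q × Fin q, Fin q × Fin q => p.2) T := by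
    rintro ⟨⟨x, y⟩, ⟨w, z⟩⟩ h₁ ⟨⟨u, v⟩, ⟨w', z'⟩⟩ h₂ heq
    obtain ⟨rfl, rfl⟩ : w = w' ∧ z = z' := by simpa using heq
    obtain ⟨hxy, ⟨hwx, hwy⟩, hzy, hxz⟩ := (mem_T _ _ _ _).1 (Finset.mem_coe.1 h₁)
    obtain ⟨huv, ⟨hwu, hwv⟩, hzv, huz⟩ := (mem_T _ _ _ _).1 (Finset.mem_coe.1 h₂)
    by_cases hxu : x = u
    · subst hxu
      by_cases hyv : y = v
      · subst hyv
        rfl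
      · exact absurd hwv (hC.no_four_cycle hwx.symm hyv hxy huv hwy)
    · by_cases hyv : y = v
      · subst hyv
        exact absurd huz (hC.no_four_cycle hxu hzy.symm hxy hxz huv)
      · exact absurd hwv (hC.no_six_cycle hxu hwx.symm hwu.symm hyv hzy.symm hzv.symm
          hxy hxz hwy huv huz)
  have disj : Disjoint C (T.image fun p => p.2) := by
    rw [Finset.disjoint_right]
    intro c hc
    obtain ⟨⟨⟨x, y⟩, ⟨w, z⟩⟩, h₁, rfl⟩ := Finset.mem_image.1 hc
    obtain ⟨hxy, ⟨hwx, hwy⟩, hzy, hxz⟩ := (mem_T _ _ _ _).1 h₁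
    exact hC.no_four_cycle hwx.symm hzy.symm hxy hxz hwy
  rw [← card_T, ← Finset.card_image_of_injOn inj, ← Finset.card_union_of_disjoint disj]
  calc _ ≤ Fintype.card (Fin q × Fin q) := Finset.card_le_univ _
    _ = q ^ 2 := by simp [sq]

/-- Summing the reciprocals of the fibre sizes over a finite set counts the nonempty fibres. -/
theorem sum_inv_card_fiber_le {α β : Type*} [Fintype β] [DecidableEq β] (C : Finset α)
    (f : α → β) :
    ∑ c ∈ C, ((C.filter fun c' => f c' = f c).card : ℝ)⁻¹ ≤ Fintype.card β := by
  classical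
  rw [← Finset.sum_fiberwise_of_maps_to (t := Finset.univ) (g := f) (fun _ _ => Finset.mem_univ _)]
  calc _ ≤ ∑ _b : β, (1 : ℝ) := by
        refine Finset.sum_le_sum fun b _ => ?_
        rw [Finset.sum_congr rfl (g := fun _ => ((C.filter fun c' => f c' = b).card : ℝ)⁻¹)
          (fun c hc => by rw [(Finset.mem_filter.1 hc).2]), Finset.sum_const, nsmul_eq_mul]
        exact mul_inv_le_one
    _ = Fintype.card β := by simp

theorem sum_inv_card_rowNbrs_le {q : ℕ} (C : Finset (Fin q × Fin q)) :
    ∑ c ∈ C, ((rowNbrs C c.1).card : ℝ)⁻¹ ≤ q := by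
  have key : ∀ x, (rowNbrs C x).card = (C.filter fun c => c.1 = x).card := fun x =>
    Finset.card_bij' (fun y _ => (x, y)) (fun c _ => c.2) (by simp [rowNbrs])
      (by rintro ⟨u, v⟩ h; simp only [Finset.mem_filter] at h; simp [rowNbrs, ← h.2, h.1])
      (by simp) (by rintro ⟨u, v⟩ h; simp only [Finset.mem_filter] at h; simp [h.2])
  simpa [key] using sum_inv_card_fiber_le C Prod.fst

theorem sum_inv_card_colNbrs_le {q : ℕ} (C : Finset (Fin q × Fin q)) :
    ∑ c ∈ C, ((colNbrs C c.2).card : ℝ)⁻¹ ≤ q := by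
  have key : ∀ y, (colNbrs C y).card = (C.filter fun c => c.2 = y).card := fun y =>
    Finset.card_bij' (fun x _ => (x, y)) (fun c _ => c.1) (by simp [colNbrs])
      (by rintro ⟨u, v⟩ h; simp only [Finset.mem_filter] at h; simp [colNbrs, ← h.2, h.1])
      (by simp) (by rintro ⟨u, v⟩ h; simp only [Finset.mem_filter] at h; simp [h.2])
  simpa [key] using sum_inv_card_fiber_le C Prod.snd

/-- The function `(s - 1) * (t - 1)` lies above its tangent plane at `s = t = d`, in the
variables `s⁻¹` and `t⁻¹`. -/
theorem tangent_le_sub_one_mul_sub_one {d s t : ℕ} (hd : 0 < d) (hs : 1 ≤ s) (ht : 1 ≤ t)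
    (h₂ : d = 2 → s ≤ 4 ∧ t ≤ 4) :
    ((d : ℝ) - 1) * (3 * d - 1) - (d - 1) * d ^ 2 * ((s : ℝ)⁻¹ + (t : ℝ)⁻¹) ≤
      ((s : ℝ) - 1) * (t - 1) := by
  have hs' : (1 : ℝ) ≤ s := by exact_mod_cast hs
  have ht' : (1 : ℝ) ≤ t := by exact_mod_cast ht
  have hd' : (1 : ℝ) ≤ d := by exact_mod_cast hd
  have hP : (0 : ℝ) < s * t := by positivity
  suffices h : ((d : ℝ) - 1) * (3 * d - 1) * (s * t) ≤
      s * t * (s * t + 1) + ((d - 1) * d ^ 2 - s * t) * (s + t) by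
    have e : ((s : ℝ)⁻¹ + (t : ℝ)⁻¹) = (s + t) / (s * t) := by
      field_simp
      ring
    have : (d - 1) * d ^ 2 * ((s + t) / (s * t)) = ((d - 1) * d ^ 2 * (s + t)) / ((s : ℝ) * t) := by
      ring
    rw [e, this, sub_le_iff_le_add, ← sub_le_iff_le_add', le_div_iff₀ hP]
    linarith
  rcases le_or_gt ((s : ℝ) * t) ((d - 1) * d ^ 2) with hk | hk
  · set p := √((s : ℝ) * t) with hp
    have hp₀ : 0 ≤ p := Real.sqrt_nonneg _
    have hpp : (s : ℝ) * t = p ^ 2 := (Real.sq_sqrt hP.le).symm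
    have hsum : 2 * p ≤ s + t := by
      refine abs_le_of_sq_le_sq' ?_ (by positivity) |>.2
      nlinarith [sq_nonneg ((s : ℝ) - t)]
    have h₁ := mul_le_mul_of_nonneg_left hsum (sub_nonneg.2 hk)
    have h₃ : 0 ≤ p * ((p - d) ^ 2 * (p + 2 * (d - 1))) :=
      mul_nonneg hp₀ (mul_nonneg (sq_nonneg _) (by linarith))
    rw [hpp] at h₁ ⊢
    linarith
  · by_cases hd₂ : d = 2
    · obtain ⟨hs₄, ht₄⟩ := h₂ hd₂
      subst hd₂
      have hk' : 4 < s * t := by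
        have : (4 : ℝ) < s * t := by
          norm_num at hk
          exact hk
        exact_mod_cast this
      have hs₂ : (2 : ℝ) ≤ s := by
        have : 2 ≤ s := by
          by_contra hlt
          obtain rfl : s = 1 := by omega
          omega
        exact_mod_cast this
      have ht₂ : (2 : ℝ) ≤ t := by
        have : 2 ≤ t := by
          by_contra hlt
          obtain rfl : t = 1 := by omega
          omega
        exact_mod_cast this
      have hsum : (s : ℝ) + t ≤ s * t / 2 + 2 := by
        linarith [mul_nonneg (sub_nonneg.2 hs₂) (sub_nonneg.2 ht₂)]
      have h₁ := mul_le_mul_of_nonneg_left hsum (sub_nonneg.2 hk.le)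
      push_cast at h₁ ⊢
      linarith [sq_nonneg ((s : ℝ) * t - 4)]
    · have hsum : (s : ℝ) + t ≤ s * t + 1 := by
        linarith [mul_nonneg (sub_nonneg.2 hs') (sub_nonneg.2 ht')]
      have h₁ := mul_le_mul_of_nonneg_left hsum (sub_nonneg.2 hk.le)
      have h₃ : 0 ≤ ((d : ℝ) - 1) * (d ^ 2 - (3 * d - 1)) := by
        rcases (by omega : d = 1 ∨ 3 ≤ d) with rfl | h
        · simp
        · have : (3 : ℝ) ≤ d := by exact_mod_cast h
          exact mul_nonneg (by linarith) (by nlinarith)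
      have h₄ := mul_nonneg h₃ hP.le
      have h₅ : 0 ≤ ((d : ℝ) - 1) * d ^ 2 := mul_nonneg (by linarith) (by positivity)
      linarith

/-- If `d² − 2d + 2 − a = 0` and `q = ad`, then any 3-MIPPC(2,M,q) has `M ≤ ad²`. -/
theorem mippc3_card_le_of_eq {a d : ℕ} (ha : 0 < a) (hd : 0 < d)
    (h : (d : ℤ) ^ 2 - 2 * d + 2 - a = 0)
    (C : Finset (Fin (a * d) × Fin (a * d))) (hC : isMIPPC2 3 C) :
    C.card ≤ a * d ^ 2 := by
  have h_a : (a : ℝ) = d ^ 2 - 2 * d + 2 := by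
    have : (d : ℝ) ^ 2 - 2 * d + 2 - a = 0 := by exact_mod_cast h
    linarith
  have hd₁ : (1 : ℝ) ≤ d := by exact_mod_cast hd
  have h_card : d = 2 → ∀ S : Finset (Fin (a * d)), S.card ≤ 4 := by
    rintro rfl S
    have : a = 2 := by push_cast at h; omega
    subst this
    simpa using Finset.card_le_univ S
  have h_row : ∀ c ∈ C, 1 ≤ (rowNbrs C c.1).card := fun c hc =>
    Finset.card_pos.2 ⟨c.2, by simpa [rowNbrs] using hc⟩
  have h_col : ∀ c ∈ C, 1 ≤ (colNbrs C c.2).card := fun c hc =>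
    Finset.card_pos.2 ⟨c.1, by simpa [colNbrs] using hc⟩
  have h_paths : (C.card : ℝ) +
      ∑ c ∈ C, (((rowNbrs C c.1).card : ℝ) - 1) * ((colNbrs C c.2).card - 1) ≤ (a * d) ^ 2 := by
    have := hC.card_add_sum_le
    have := (Nat.cast_le (α := ℝ)).2 this
    push_cast at this
    rwa [Finset.sum_congr rfl fun c hc => by
      rw [Nat.cast_sub (h_row c hc), Nat.cast_sub (h_col c hc), Nat.cast_one]] at this
  have h_tangent := Finset.sum_le_sum fun c hc =>
    tangent_le_sub_one_mul_sub_one hd (h_row c hc) (h_col c hc)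
      fun h₂ => ⟨h_card h₂ _, h_card h₂ _⟩
  rw [Finset.sum_sub_distrib, Finset.sum_const, nsmul_eq_mul, ← Finset.mul_sum,
    Finset.sum_add_distrib] at h_tangent
  have h_inv := mul_le_mul_of_nonneg_left
    (add_le_add (sum_inv_card_rowNbrs_le C) (sum_inv_card_colNbrs_le C))
    (mul_nonneg (sub_nonneg.2 hd₁) (sq_nonneg (d : ℝ)))
  push_cast at h_inv
  have h_mul : (C.card : ℝ) * (3 * d ^ 2 - 4 * d + 2) ≤ a * d ^ 2 * (3 * d ^ 2 - 4 * d + 2) := by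
    have e : (a : ℝ) * d ^ 2 * (3 * d ^ 2 - 4 * d + 2) =
        (a * d) ^ 2 + (d - 1) * d ^ 2 * (a * d + a * d) := by
      rw [h_a]
      ring
    linarith
  have := le_of_mul_le_mul_right h_mul (by nlinarith)
  exact_mod_cast this
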